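/- Let m ≥ 1, D ≥ 1 and W ≥ 1 be integers, let u ∈ {0,1}^m have Hamming weight w ≥ 1 such that w·D divides W, and let U be an integer. For q ∈ {0, 1, …, D−1} define A_q = {y ∈ {1, …, m⁴}^m : ((Σ_{i=1}^m y_i u_i) + U) mod W ∈ [q·W/D, (q+1)·W/D)}. Then for every q, | |A_q| − m^{4m}/D | ≤ W·m^{4m−4}. -/

import Mathlib

/-- Counting the points of a box by the lines parallel to the `i`-th axis. -/
lemma card_filter_piFinset_eq_sum_update {ι : Type*} [Fintype ι] [DecidableEq ι] {α : Type*}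
    [DecidableEq α] (s : ι → Finset α) (i : ι) {a : α} (ha : a ∈ s i) (P : (ι → α) → Prop)
    [DecidablePred P] :
    ((Fintype.piFinset s).filter P).card =
      ∑ z ∈ Fintype.piFinset (Function.update s i {a}),
        ((s i).filter fun k => P (Function.update z i k)).card := by
  rw [Finset.card_eq_sum_card_fiberwise (f := fun y => Function.update y i a)
    (t := Fintype.piFinset (Function.update s i {a}))]
  · refine Finset.sum_congr rfl fun z hz => ?_
    rw [Fintype.mem_piFinset] at hz
    have hzi : z i = a := by simpa using hz i
    have hzj : ∀ j, j ≠ i → z j ∈ s j := fun j hj => by simpa [hj] using hz j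
    refine Finset.card_bij' (fun y _ => y i) (fun k _ => Function.update z i k) ?_ ?_ ?_ ?_
    · intro y hy
      simp only [Finset.mem_filter, Fintype.mem_piFinset] at hy ⊢
      obtain ⟨⟨hy, hP⟩, rfl⟩ := hy
      exact ⟨hy i, by simpa using hP⟩
    · intro k hk
      simp only [Finset.mem_filter, Fintype.mem_piFinset] at hk ⊢
      refine ⟨⟨fun j => ?_, hk.2⟩, by simp [← hzi]⟩
      by_cases hj : j = i
      · subst hj
        simpa using hk.1
      · simpa [hj] using hzj j hj
    · intro y hy
      simp only [Finset.mem_filter] at hy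
      obtain ⟨-, rfl⟩ := hy
      simp
    · intro k _
      simp
  · intro y hy
    simp only [Finset.coe_filter, Set.mem_ofPred_eq, Fintype.mem_piFinset] at hy
    simp only [Finset.mem_coe, Fintype.mem_piFinset]
    intro j
    by_cases hj : j = i
    · subst hj
      simp
    · simpa [hj] using hy.1 j

/-- A residue class modulo `W` contains `n / W` elements of `{1, …, n}`, up to an error of `1`. -/
lemma abs_card_filter_emod_eq_sub_le (n W : ℕ) (hW : 0 < W) (c t : ℤ) (ht₀ : 0 ≤ t)
    (ht : t < W) :
    |(((Finset.Icc 1 n).filter fun k : ℕ => ((k : ℤ) + c) % (W : ℤ) = t).card : ℝ) -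
      (n : ℝ) / W| ≤ 1 := by
  have hW' : (0 : ℤ) < W := by exact_mod_cast hW
  obtain ⟨v, hv⟩ := Int.eq_ofNat_of_zero_le (Int.emod_nonneg (t - c) hW'.ne')
  have hfilter : ((Finset.Icc 1 n).filter fun k : ℕ => ((k : ℤ) + c) % (W : ℤ) = t) =
      (Finset.Ioc 0 n).filter fun k : ℕ => k ≡ v [MOD W] := by
    ext k
    simp only [Finset.mem_filter, Finset.mem_Icc, Finset.mem_Ioc]
    refine and_congr Iff.rfl ?_
    rw [← Int.natCast_modEq_iff, ← hv, Int.ModEq, Int.emod_emod,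
      Int.emod_eq_emod_iff_emod_sub_eq_zero, sub_sub_eq_add_sub,
      ← Int.emod_eq_emod_iff_emod_sub_eq_zero, Int.emod_eq_of_lt ht₀ ht]
  have hcard := Nat.Ioc_filter_modEq_card 0 n hW v
  rw [← hfilter] at hcard
  set N := ((Finset.Icc 1 n).filter fun k : ℕ => ((k : ℤ) + c) % (W : ℤ) = t).card
  set x : ℚ := ((n : ℚ) - v) / W with hx
  set y : ℚ := (((0 : ℕ) : ℚ) - v) / W with hy
  have hxy : x - y = (n : ℚ) / W := by rw [hx, hy]; push_cast; ring
  have hle : y ≤ x := by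
    have : (0 : ℚ) ≤ (n : ℚ) / W := by positivity
    linarith
  rw [max_eq_left (sub_nonneg.2 (Int.floor_mono hle))] at hcard
  have hcardQ : (N : ℚ) = (⌊x⌋ : ℚ) - ⌊y⌋ := by exact_mod_cast hcard
  have key : |(N : ℚ) - (n : ℚ) / W| ≤ 1 := by
    rw [abs_le, hcardQ, ← hxy]
    constructor <;>
      linarith [Int.floor_le x, Int.floor_le y, Int.lt_floor_add_one x, Int.lt_floor_add_one y]
  have keyR : |((N : ℚ) : ℝ) - (((n : ℚ) / W : ℚ) : ℝ)| ≤ 1 := by exact_mod_cast key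
  push_cast at keyR
  exact keyR

/-- The elements of `{1, …, n}` whose translate by `c` has residue modulo `W` in a given
interval of `b - a` residues number `(b - a) * n / W`, up to an error of `b - a`. -/
lemma abs_card_filter_emod_mem_sub_le (n W : ℕ) (hW : 0 < W) (c a b : ℤ) (ha : 0 ≤ a)
    (hab : a ≤ b) (hb : b ≤ W) :
    |(((Finset.Icc 1 n).filter fun k : ℕ =>
        a ≤ ((k : ℤ) + c) % (W : ℤ) ∧ ((k : ℤ) + c) % (W : ℤ) < b).card : ℝ) -
      ((b - a : ℤ) : ℝ) * ((n : ℝ) / W)| ≤ ((b - a : ℤ) : ℝ) := by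
  have hcard : (((b - a).toNat : ℕ) : ℝ) = ((b - a : ℤ) : ℝ) := by
    exact_mod_cast Int.toNat_of_nonneg (sub_nonneg.2 hab)
  rw [Finset.card_eq_sum_card_fiberwise (f := fun k : ℕ => ((k : ℤ) + c) % (W : ℤ))
    (t := Finset.Ico a b) (fun k hk => by simpa using (Finset.mem_filter.1 hk).2)]
  have hsum : ((b - a : ℤ) : ℝ) * ((n : ℝ) / W) = ∑ _t ∈ Finset.Ico a b, (n : ℝ) / W := by
    rw [Finset.sum_const, Int.card_Ico, nsmul_eq_mul, hcard]
  rw [Nat.cast_sum, hsum, ← Finset.sum_sub_distrib]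
  refine (Finset.abs_sum_le_sum_abs _ _).trans ?_
  refine (Finset.sum_le_card_nsmul _ _ 1 fun t ht => ?_).trans_eq ?_
  · rw [Finset.mem_Ico] at ht
    rw [Finset.filter_filter, Finset.filter_congr (q := fun k : ℕ => ((k : ℤ) + c) % (W : ℤ) = t)
      fun k _ => ⟨And.right, fun h => ⟨h ▸ ht, h⟩⟩]
    exact abs_card_filter_emod_eq_sub_le n W hW c t (by lia) (by lia)
  · rw [Int.card_Ico, nsmul_eq_mul, hcard, mul_one]


/-- Hyperplane slab counting in the hypercube `{1, …, m⁴}^m`. Let `m, D, W ≥ 1` be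
integers, let `u ∈ {0,1}^m` have Hamming weight `w = ∑ i, u i ≥ 1` with `w·D ∣ W`, and let
`U` be an integer. For `q < D` set
`A_q = {y ∈ {1,…,m⁴}^m : ((y,u) + U) mod W ∈ [q·W/D, (q+1)·W/D)}`.
Then `| |A_q| − m^{4m}/D | ≤ W·m^{4m−4}`. -/
theorem stmt_18 (m D W : ℕ) (hm : 1 ≤ m) (hD : 1 ≤ D) (hW : 1 ≤ W)
    (u : Fin m → ℕ) (hu : ∀ i, u i ≤ 1)
    (hw : 1 ≤ ∑ i, u i) (hdvd : (∑ i, u i) * D ∣ W)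
    (U : ℤ) (q : ℕ) (hq : q < D) :
    |(((Fintype.piFinset fun _ : Fin m => Finset.Icc 1 (m ^ 4)).filter
          (fun y : Fin m → ℕ =>
            (q : ℤ) * ((W / D : ℕ) : ℤ) ≤ ((∑ i, (y i : ℤ) * (u i : ℤ)) + U) % (W : ℤ) ∧
            ((∑ i, (y i : ℤ) * (u i : ℤ)) + U) % (W : ℤ) <
              ((q : ℤ) + 1) * ((W / D : ℕ) : ℤ))).card : ℝ) -
        (m : ℝ) ^ (4 * m) / (D : ℝ)| ≤ (W : ℝ) * (m : ℝ) ^ (4 * m - 4) := by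
  obtain ⟨i, -, hi⟩ := Finset.exists_ne_zero_of_sum_ne_zero (Nat.one_le_iff_ne_zero.1 hw)
  have hui : u i = 1 := le_antisymm (hu i) (Nat.one_le_iff_ne_zero.2 hi)
  obtain ⟨L, rfl⟩ : D ∣ W := (Dvd.intro_left _ rfl).trans hdvd
  rw [Nat.mul_div_cancel_left L hD]
  have hDR : (0 : ℝ) < D := by exact_mod_cast hD
  have hLR : (0 : ℝ) < L := by exact_mod_cast Nat.pos_of_mul_pos_left hW
  rw [card_filter_piFinset_eq_sum_update
    (fun _ : Fin m => Finset.Icc 1 (m ^ 4)) i (a := 1)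
    (Finset.mem_Icc.2 ⟨le_rfl, Nat.one_le_pow _ _ hm⟩)]
  set T := Fintype.piFinset
    (Function.update (fun _ : Fin m => Finset.Icc 1 (m ^ 4)) i {1}) with hT
  have hTcard : T.card = m ^ (4 * m - 4) := by
    rw [hT, Fintype.card_piFinset, ← Finset.mul_prod_erase _ _ (Finset.mem_univ i),
      Finset.prod_congr rfl (g := fun _ => m ^ 4)
        (fun j hj => by simp [Finset.ne_of_mem_erase hj])]
    simp [Finset.card_erase_of_mem, ← pow_mul, Nat.mul_sub]
  have hTR : (T.card : ℝ) = (m : ℝ) ^ (4 * m - 4) := by exact_mod_cast hTcard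
  have hmain : (m : ℝ) ^ (4 * m) / D = ∑ _z ∈ T, (m : ℝ) ^ 4 / D := by
    rw [Finset.sum_const, nsmul_eq_mul, hTR, ← mul_div_assoc, ← pow_add,
      Nat.sub_add_cancel (by lia)]
  rw [Nat.cast_sum, hmain, ← Finset.sum_sub_distrib]
  refine (Finset.abs_sum_le_sum_abs _ _).trans ?_
  refine (Finset.sum_le_card_nsmul _ _ (L : ℝ) fun z _ => ?_).trans ?_
  · have hdot : ∀ k : ℕ, (∑ j, (Function.update z i k j : ℤ) * (u j : ℤ)) + U =
        (k : ℤ) + ((∑ j ∈ Finset.univ.erase i, (z j : ℤ) * (u j : ℤ)) + U) := by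
      intro k
      rw [← Finset.add_sum_erase _ _ (Finset.mem_univ i), Finset.sum_congr rfl
        (g := fun j => (z j : ℤ) * (u j : ℤ))
        (fun j hj => by simp [Finset.ne_of_mem_erase hj])]
      simp [hui, add_assoc]
    simp only [hdot]
    have hline := abs_card_filter_emod_mem_sub_le (m ^ 4) (D * L) hW
      ((∑ j ∈ Finset.univ.erase i, (z j : ℤ) * (u j : ℤ)) + U) (q * L) ((q + 1) * L)
      (by positivity) (by nlinarith)
      (by
        push_cast
        exact mul_le_mul_of_nonneg_right (by exact_mod_cast hq) (by positivity))
    have hlen : (((q : ℤ) + 1) * L - q * L : ℤ) = L := by ring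
    have hdens : (L : ℝ) * ((m : ℝ) ^ 4 / ((D : ℝ) * L)) = (m : ℝ) ^ 4 / D := by
      field_simp
    rw [hlen] at hline
    push_cast at hline hdens ⊢
    rwa [hdens] at hline
  · rw [nsmul_eq_mul, hTR, mul_comm]
    push_cast
    gcongr
    exact le_mul_of_one_le_left hLR.le (by exact_mod_cast hD)
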